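/- arXiv:2509.04314 — 2 statements merged into one kernel-verified Lean document; each statement's English description precedes it below -/
import Mathlib

section
/- Let m ≥ 2 and d ≥ 1, and let B be a homogeneous polynomial of degree d with real coefficients in x_1,…,x_m that is coefficientwise nonnegative. Suppose that either B has exactly one nonzero coefficient, or B has exactly two nonzero coefficients and |supp(B·S_m)| = 2m − 1. Then there exist an exponent vector μ ∈ ℕ^m with |μ| = d − 1 and a real number c > 0 such that c·x^μ·S_m − B is coefficientwise nonnegative. -/
open MvPolynomial

theorem exists_pos_coeff_monomial_mul_sum_X_sub_nonneg {σ : Type*} [Fintype σ]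
    {B : MvPolynomial σ ℝ} {μ : σ →₀ ℕ}
    (hpos : ∀ mo, 0 ≤ coeff mo B)
    (h : ∀ a ∈ B.support, ∃ i, a = μ + Finsupp.single i 1) :
    ∃ c : ℝ, 0 < c ∧ ∀ mo, 0 ≤ coeff mo (C c * monomial μ 1 * ∑ i, X i - B) := by
  classical
  have hsum : 0 ≤ ∑ a ∈ B.support, coeff a B := Finset.sum_nonneg fun a _ => hpos a
  refine ⟨1 + ∑ a ∈ B.support, coeff a B, by linarith, fun mo => ?_⟩
  set c := 1 + ∑ a ∈ B.support, coeff a B with hc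
  have hterm : ∀ i, coeff mo (C c * monomial μ 1 * X i) =
      if μ + Finsupp.single i 1 = mo then c else 0 := fun i => by
    rw [C_mul_monomial, X, monomial_mul, coeff_monomial, mul_one, mul_one]
  have hterm_nonneg : ∀ i ∈ Finset.univ, 0 ≤ coeff mo (C c * monomial μ 1 * X i) := fun i _ => by
    rw [hterm]; split_ifs <;> linarith
  rw [coeff_sub, Finset.mul_sum, coeff_sum, sub_nonneg]
  by_cases hmo : mo ∈ B.support
  · obtain ⟨i, hi⟩ := h mo hmo
    calc coeff mo B ≤ ∑ a ∈ B.support, coeff a B :=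
          Finset.single_le_sum (f := fun a => coeff a B) (fun a _ => hpos a) hmo
      _ ≤ c := by linarith
      _ = coeff mo (C c * monomial μ 1 * X i) := by rw [hterm, if_pos hi.symm]
      _ ≤ _ := Finset.single_le_sum hterm_nonneg (Finset.mem_univ i)
  · rw [notMem_support_iff.mp hmo]
    exact Finset.sum_nonneg hterm_nonneg

theorem add_single_mem_support_mul_sum_X {σ : Type*} [Fintype σ] {B : MvPolynomial σ ℝ}
    (hpos : ∀ mo, 0 ≤ coeff mo B) {a : σ →₀ ℕ} (ha : a ∈ B.support) (i : σ) :
    a + Finsupp.single i 1 ∈ (B * ∑ i, X i).support := by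
  classical
  rw [mem_support_iff, Finset.mul_sum, coeff_sum]
  refine (Finset.sum_pos' (fun j _ => ?_) ⟨i, Finset.mem_univ i, ?_⟩).ne'
  · rw [coeff_mul_X']
    split_ifs
    exacts [hpos _, le_rfl]
  · rw [coeff_mul_X]
    exact (hpos a).lt_of_ne' (mem_support_iff.mp ha)

theorem exists_add_single_eq_add_single_of_card_support_lt {σ : Type*} [Fintype σ]
    {B : MvPolynomial σ ℝ} (hpos : ∀ mo, 0 ≤ coeff mo B) {a b : σ →₀ ℕ}
    (ha : a ∈ B.support) (hb : b ∈ B.support)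
    (hcard : (B * ∑ i, X i).support.card < 2 * Fintype.card σ) :
    ∃ i j, a + Finsupp.single i 1 = b + Finsupp.single j 1 := by
  classical
  by_contra! hne
  have hinj : ∀ e : σ →₀ ℕ, Function.Injective fun i => e + Finsupp.single i 1 :=
    fun e i j hij => Finsupp.single_left_injective one_ne_zero (add_left_cancel hij)
  have hle := Finset.card_le_card_of_injOn (s := (Finset.univ : Finset (σ ⊕ σ)))
    (t := (B * ∑ i, X i).support)
    (Sum.elim (fun i => a + Finsupp.single i 1) fun i => b + Finsupp.single i 1)
    (by
      rintro (i | i) -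
      exacts [add_single_mem_support_mul_sum_X hpos ha i,
        add_single_mem_support_mul_sum_X hpos hb i])
    ((hinj a).sumElim (hinj b) hne).injOn
  rw [Finset.card_univ, Fintype.card_sum] at hle
  omega

theorem exists_eq_add_single {σ : Type*} {a : σ →₀ ℕ} {j : σ} (hj : a j ≠ 0) :
    ∃ μ, a = μ + Finsupp.single j 1 :=
  ⟨a - Finsupp.single j 1, (tsub_add_cancel_of_le (by
    simpa [Finsupp.single_le_iff] using Nat.one_le_iff_ne_zero.mpr hj)).symm⟩

/-- Existence of a rank-one patch vector (Case III-3 of Section 5): if `B` is homogeneous of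
degree `d ≥ 1` in `m ≥ 2` variables with nonnegative coefficients, and either `B` has exactly
one nonzero coefficient, or `B` has exactly two nonzero coefficients and
`|supp(B·S_m)| = 2m − 1`, then there exist `μ` with `|μ| = d − 1` and `c > 0` such that
`c·x^μ·S_m − B` has nonnegative coefficients. -/
theorem stmt17 (m d : ℕ) (hm : 2 ≤ m) (hd : 1 ≤ d)
    (B : MvPolynomial (Fin m) ℝ) (hB : B.IsHomogeneous d)
    (hpos : ∀ mo, 0 ≤ coeff mo B)
    (S : MvPolynomial (Fin m) ℝ) (hS : S = ∑ i, X i)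
    (hcase : B.support.card = 1 ∨
      (B.support.card = 2 ∧ (B * S).support.card = 2 * m - 1)) :
    ∃ (μ : Fin m →₀ ℕ) (c : ℝ), (∑ i, μ i) = d - 1 ∧ 0 < c ∧
      ∀ mo, 0 ≤ coeff mo (C c * monomial μ 1 * S - B) := by
  subst hS
  have hdeg : ∀ a ∈ B.support, ∑ i, a i = d := fun a ha => by
    rw [← Finsupp.degree_eq_sum, Finsupp.degree_eq_weight_one]
    exact hB (mem_support_iff.mp ha)
  suffices h : ∃ μ : Fin m →₀ ℕ, ∀ a ∈ B.support, ∃ i, a = μ + Finsupp.single i 1 by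
    obtain ⟨μ, hμ⟩ := h
    obtain ⟨c, hc, hnonneg⟩ := exists_pos_coeff_monomial_mul_sum_X_sub_nonneg hpos hμ
    refine ⟨μ, c, ?_, hc, hnonneg⟩
    obtain ⟨a, ha⟩ : B.support.Nonempty := Finset.card_pos.mp (by omega)
    obtain ⟨i, rfl⟩ := hμ a ha
    have hsum := hdeg _ ha
    simp only [Finsupp.add_apply, Finset.sum_add_distrib, Finsupp.univ_sum_single_apply] at hsum
    omega
  rcases hcase with h1 | ⟨h2, hS⟩
  · obtain ⟨a, ha⟩ := Finset.card_eq_one.mp h1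
    have ha0 : a ≠ 0 := by
      rintro rfl
      have hsum := hdeg 0 (by simp [ha])
      simp only [Finsupp.coe_zero, Pi.zero_apply, Finset.sum_const_zero] at hsum
      omega
    obtain ⟨j, hj⟩ := Finsupp.ne_iff.mp ha0
    obtain ⟨μ, hμ⟩ := exists_eq_add_single hj
    refine ⟨μ, fun e he => ⟨j, ?_⟩⟩
    rw [ha, Finset.mem_singleton] at he
    rw [he, hμ]
  · obtain ⟨a, b, hab, hsupp⟩ := Finset.card_eq_two.mp h2
    obtain ⟨i, j, hij⟩ := exists_add_single_eq_add_single_of_card_support_lt hpos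
      (a := a) (b := b) (by simp [hsupp]) (by simp [hsupp]) (by rw [hS, Fintype.card_fin]; omega)
    have hne : i ≠ j := by
      rintro rfl
      exact hab (add_right_cancel hij)
    have haj : a j ≠ 0 := by
      have := DFunLike.congr_fun hij j
      simp [hne] at this
      omega
    obtain ⟨μ, rfl⟩ := exists_eq_add_single haj
    have hb : b = μ + Finsupp.single i 1 := by
      rw [add_right_comm] at hij
      exact (add_right_cancel hij).symm
    refine ⟨μ, fun e he => ?_⟩
    rw [hsupp, Finset.mem_insert, Finset.mem_singleton] at he
    rcases he with rfl | rfl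
    exacts [⟨j, rfl⟩, ⟨i, hb⟩]
end

section
/- For integers m ≥ 2 and e ≥ 2, define ρ(m,e) as the infimum of |supp(B·S_m)| over all homogeneous polynomials B of degree e with real coefficients in x_1,…,x_m such that B has at least one negative coefficient and B·S_m is coefficientwise nonnegative. Then for all n ≥ 3 and d ≥ 3 and every homogeneous polynomial A of degree d in x_1,…,x_n that has a negative coefficient and for which A·S_n is coefficientwise nonnegative, one has |supp(A·S_n)| ≥ min{ ρ(n, d−1), 3 + ρ(n−1, d), 3n − 4 }. -/
open MvPolynomial

/-- The sum of the variables `S_m = x_1 + ⋯ + x_m` in `m` variables. -/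
noncomputable def Ssum (m : ℕ) : MvPolynomial (Fin m) ℝ := ∑ i, X i

/-- `ρ(m,e)`: the infimum (in `ℕ∞`) of `|supp(B·S_m)|` over all homogeneous polynomials `B` of
degree `e` in `m` variables having a negative coefficient and with `B·S_m` coefficientwise
nonnegative. -/
noncomputable def rho (m e : ℕ) : ℕ∞ :=
  sInf {k : ℕ∞ | ∃ B : MvPolynomial (Fin m) ℝ, B.IsHomogeneous e ∧
    (∃ mo, coeff mo B < 0) ∧
    (∀ mo, 0 ≤ coeff mo (B * Ssum m)) ∧
    ((B * Ssum m).support.card : ℕ∞) = k}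


section Coefficients

variable {n : ℕ}

theorem coeff_mul_Ssum (A : MvPolynomial (Fin n) ℝ) (β : Fin n →₀ ℕ) :
    coeff β (A * Ssum n) = ∑ l, if β l = 0 then 0 else coeff (β - Finsupp.single l 1) A := by
  rw [Ssum, Finset.mul_sum, coeff_sum]
  refine Finset.sum_congr rfl fun l _ => ?_
  rw [coeff_mul_X']
  by_cases h : β l = 0 <;> simp [h]

theorem coeff_add_single_pos {A : MvPolynomial (Fin n) ℝ} {α : Fin n →₀ ℕ} {i : Fin n}
    (hA : ∀ j, j ≠ i → 0 ≤ coeff (α + Finsupp.single i 1 - Finsupp.single j 1) A)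
    (hα : 0 < coeff α A) : 0 < coeff (α + Finsupp.single i 1) (A * Ssum n) := by
  rw [coeff_mul_Ssum]
  refine Finset.sum_pos' (fun j _ => ?_) ⟨i, Finset.mem_univ i, by simpa using hα⟩
  split_ifs
  · exact le_rfl
  · rcases eq_or_ne j i with rfl | hj
    · simpa using hα.le
    · exact hA j hj

theorem degree_eq_of_coeff_ne_zero {A : MvPolynomial (Fin n) ℝ} {d : ℕ} (hA : A.IsHomogeneous d)
    {α : Fin n →₀ ℕ} (hα : coeff α A ≠ 0) : ∑ i, α i = d := by
  rw [← hA hα, ← Finsupp.degree_eq_sum, Finsupp.degree_eq_weight_one, Pi.one_def]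

theorem Ssum_isHomogeneous (n : ℕ) : (Ssum n).IsHomogeneous 1 :=
  IsHomogeneous.sum _ _ _ fun i _ => isHomogeneous_X ℝ i

theorem Ssum_ne_zero (hn : 0 < n) : Ssum n ≠ 0 := by
  intro h
  have := congrArg (eval fun _ => (1 : ℝ)) h
  simp [Ssum] at this
  omega

/-- All coefficients of `p` are nonnegative. -/
def CoeffNonneg (p : MvPolynomial (Fin n) ℝ) : Prop := ∀ mo, 0 ≤ coeff mo p

namespace CoeffNonneg

variable {p q : MvPolynomial (Fin n) ℝ}

theorem add (hp : CoeffNonneg p) (hq : CoeffNonneg q) : CoeffNonneg (p + q) := fun mo => by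
  rw [coeff_add]
  exact add_nonneg (hp mo) (hq mo)

theorem mul (hp : CoeffNonneg p) (hq : CoeffNonneg q) : CoeffNonneg (p * q) := fun mo => by
  rw [coeff_mul]
  exact Finset.sum_nonneg fun x _ => mul_nonneg (hp _) (hq _)

theorem monomial (s : Fin n →₀ ℕ) {c : ℝ} (hc : 0 ≤ c) :
    CoeffNonneg (MvPolynomial.monomial s c) := fun mo => by
  rw [coeff_monomial]
  split_ifs <;> simp [hc]

theorem pow (hp : CoeffNonneg p) (k : ℕ) : CoeffNonneg (p ^ k) := by
  induction k with
  | zero => simpa using monomial (0 : Fin n →₀ ℕ) zero_le_one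
  | succ k ih => rw [pow_succ]; exact ih.mul hp

theorem sum {ι : Type*} {s : Finset ι} {f : ι → MvPolynomial (Fin n) ℝ}
    (hf : ∀ x ∈ s, CoeffNonneg (f x)) : CoeffNonneg (∑ x ∈ s, f x) := fun mo => by
  rw [coeff_sum]
  exact Finset.sum_nonneg fun x hx => hf x hx mo

end CoeffNonneg

theorem coeffNonneg_Ssum (n : ℕ) : CoeffNonneg (Ssum n) :=
  CoeffNonneg.sum fun i _ => CoeffNonneg.monomial (Finsupp.single i 1) zero_le_one

end Coefficients

/-- If every monomial of `A` is divisible by the variable `X i`, then dividing by `X i` yields a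
competitor for `rho n (d - 1)`. -/
theorem rho_pred_le_of_X_dvd {n d : ℕ} {A : MvPolynomial (Fin n) ℝ} (hA : A.IsHomogeneous d)
    (hd : 1 ≤ d) (hneg : ∃ mo, coeff mo A < 0) (hpos : ∀ mo, 0 ≤ coeff mo (A * Ssum n))
    (i : Fin n) (hi : ∀ α : Fin n →₀ ℕ, α i = 0 → coeff α A = 0) :
    rho n (d - 1) ≤ ((A * Ssum n).support.card : ℕ∞) := by
  obtain ⟨B, rfl⟩ : X i ∣ A := by
    rw [X_dvd_iff_modMonomial_eq_zero]
    ext α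
    rw [coeff_zero]
    by_cases h : Finsupp.single i 1 ≤ α
    · exact coeff_modMonomial_of_le _ h
    · rw [coeff_modMonomial_of_not_le _ h]
      refine hi α ?_
      rw [Finsupp.single_le_iff] at h
      omega
  refine sInf_le ⟨B, ?_, ?_, ?_, ?_⟩
  · intro γ hγ
    have h := hA (d := Finsupp.single i 1 + γ) (by rwa [coeff_X_mul])
    rw [map_add, Finsupp.weight_single] at h
    simp at h
    omega
  · obtain ⟨mo, hmo⟩ := hneg
    rw [coeff_X_mul'] at hmo
    split_ifs at hmo with h
    · exact ⟨_, hmo⟩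
    · exact absurd hmo (lt_irrefl _)
  · intro mo
    have := hpos (Finsupp.single i 1 + mo)
    rwa [mul_assoc, coeff_X_mul] at this
  · rw [mul_assoc, support_X_mul, Finset.card_map]

section Shifts

variable {n : ℕ}

theorem exists_ne_ne (hn : 3 ≤ n) (i l : Fin n) : ∃ b, b ≠ i ∧ b ≠ l := by
  by_contra! h
  have h1 : (Finset.univ : Finset (Fin n)) ⊆ {i, l} := fun b _ => by
    by_cases hb : b = i
    · simp [hb]
    · simp [h b hb]
  have h2 := (Finset.card_le_card h1).trans Finset.card_le_two
  rw [Finset.card_univ, Fintype.card_fin] at h2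
  omega

/-- The exponents `α + e_l` for `l ∈ L`. -/
noncomputable def shifts (α : Fin n →₀ ℕ) (L : Finset (Fin n)) : Finset (Fin n →₀ ℕ) :=
  L.image fun l => α + Finsupp.single l 1

theorem mem_shifts {α x : Fin n →₀ ℕ} {L : Finset (Fin n)} :
    x ∈ shifts α L ↔ ∃ l ∈ L, α + Finsupp.single l 1 = x := by
  simp [shifts]

theorem card_shifts (α : Fin n →₀ ℕ) (L : Finset (Fin n)) : (shifts α L).card = L.card := by
  refine Finset.card_image_of_injective _ fun l m h => ?_
  exact Finsupp.single_left_injective one_ne_zero (add_left_cancel h)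

theorem card_shifts_inter_le {α β : Fin n →₀ ℕ} (h : α ≠ β) (L M : Finset (Fin n)) :
    (shifts α L ∩ shifts β M).card ≤ 1 := by
  rw [Finset.card_le_one]
  intro x hx y hy
  rw [Finset.mem_inter, mem_shifts, mem_shifts] at hx hy
  obtain ⟨⟨l, -, rfl⟩, m, -, hx⟩ := hx
  obtain ⟨⟨l', -, rfl⟩, m', -, hy⟩ := hy
  have hlm : l ≠ m := by
    rintro rfl
    exact h (add_right_cancel hx).symm
  have h1 := DFunLike.congr_fun hx l
  have h2 := DFunLike.congr_fun hy l
  simp only [Finsupp.add_apply, Finsupp.single_apply, if_true] at h1 h2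
  rw [if_neg hlm.symm] at h1
  have : l' = l := by
    by_contra hne
    rw [if_neg hne] at h2
    omega
  rw [this]

theorem card_union_three {ι : Type*} [DecidableEq ι] (s t u : Finset ι) :
    s.card + t.card + u.card ≤
      (s ∪ t ∪ u).card + (s ∩ t).card + (s ∩ u).card + (t ∩ u).card := by
  have h1 := Finset.card_union_add_card_inter s t
  have h2 := Finset.card_union_add_card_inter (s ∪ t) u
  have h3 := Finset.card_union_le (s ∩ u) (t ∩ u)
  rw [Finset.union_inter_distrib_right] at h2
  omega

/-- The directions `l` such that `α + e_l` still misses some variable. -/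
def boundaryDirs (α : Fin n →₀ ℕ) : Finset (Fin n) :=
  Finset.univ.filter fun l => ∃ i, i ≠ l ∧ α i = 0

theorem mem_boundaryDirs {α : Fin n →₀ ℕ} {l : Fin n} :
    l ∈ boundaryDirs α ↔ ∃ i, i ≠ l ∧ α i = 0 := by
  simp [boundaryDirs]

theorem le_card_boundaryDirs {α : Fin n →₀ ℕ} {i : Fin n} (hi : α i = 0) :
    n ≤ (boundaryDirs α).card + 1 := by
  have h : Finset.univ.erase i ⊆ boundaryDirs α := fun l hl =>
    mem_boundaryDirs.2 ⟨i, (Finset.ne_of_mem_erase hl).symm, hi⟩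
  have := Finset.card_le_card h
  rw [Finset.card_erase_of_mem (Finset.mem_univ i), Finset.card_univ, Fintype.card_fin] at this
  omega

theorem card_inter_add_card_inter_le {α β γ : Fin n →₀ ℕ} (hα : ∃ i, α i = 0) (hβ : α ≠ β)
    (hγ : α ≠ γ) (h : ∀ i, α i = 0 → β i = 0 → γ i ≠ 0) (L M : Finset (Fin n)) :
    (shifts α (boundaryDirs α) ∩ shifts β L).card +
      (shifts α (boundaryDirs α) ∩ shifts γ M).card + n ≤ (boundaryDirs α).card + 2 := by
  have h1 := card_shifts_inter_le hβ (boundaryDirs α) L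
  have h2 := card_shifts_inter_le hγ (boundaryDirs α) M
  obtain ⟨i, hi⟩ := hα
  have h3 := le_card_boundaryDirs hi
  by_cases hu : boundaryDirs α = Finset.univ
  · have h4 : (boundaryDirs α).card = n := by rw [hu, Finset.card_univ, Fintype.card_fin]
    omega
  · obtain ⟨l, hl⟩ : ∃ l, l ∉ boundaryDirs α := by
      by_contra! hall
      exact hu (Finset.eq_univ_iff_forall.2 hall)
    have hαl : ∀ j, α j = 0 → j = l := fun j hj => by
      by_contra hne
      exact hl (mem_boundaryDirs.2 ⟨j, hne, hj⟩)
    obtain rfl := hαl i hi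
    have key : ∀ (δ : Fin n →₀ ℕ) (N : Finset (Fin n)),
        (shifts α (boundaryDirs α) ∩ shifts δ N).card ≠ 0 → δ i = 0 := by
      intro δ N hne
      obtain ⟨x, hx⟩ := Finset.card_ne_zero.1 hne
      rw [Finset.mem_inter, mem_shifts, mem_shifts] at hx
      obtain ⟨⟨l, hl', rfl⟩, m, -, hx⟩ := hx
      have hli : l ≠ i := fun h => hl (h ▸ hl')
      have := DFunLike.congr_fun hx i
      simp only [Finsupp.add_apply, Finsupp.single_apply, if_neg hli, hi] at this
      omega
    by_contra hcon
    exact h i hi (key β L (by omega)) (key γ M (by omega))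

end Shifts

section BoundaryNonneg

variable {n d : ℕ} {A : MvPolynomial (Fin n) ℝ}

theorem coeff_add_single_pos_of_boundary
    (hA : ∀ α : Fin n →₀ ℕ, (∃ i, α i = 0) → 0 ≤ coeff α A) {α : Fin n →₀ ℕ}
    (hα : 0 < coeff α A) {i l : Fin n} (hi : α i = 0) (hl : i ≠ l) :
    0 < coeff (α + Finsupp.single l 1) (A * Ssum n) :=
  coeff_add_single_pos (fun j _ => hA _ ⟨i, by simp [hi, hl.symm]⟩) hα

theorem shifts_boundaryDirs_subset_support
    (hA : ∀ α : Fin n →₀ ℕ, (∃ i, α i = 0) → 0 ≤ coeff α A) {α : Fin n →₀ ℕ}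
    (hα : 0 < coeff α A) : shifts α (boundaryDirs α) ⊆ (A * Ssum n).support := by
  intro x hx
  obtain ⟨l, hl, rfl⟩ := mem_shifts.1 hx
  obtain ⟨i, hil, hi⟩ := mem_boundaryDirs.1 hl
  exact mem_support_iff.2 (coeff_add_single_pos_of_boundary hA hα hi hil).ne'

/-- Three monomials of `A` without a common missing variable. -/
theorem card_support_ge_of_three_not_common
    (hA : ∀ α : Fin n →₀ ℕ, (∃ i, α i = 0) → 0 ≤ coeff α A) {α β γ : Fin n →₀ ℕ}
    (hα : 0 < coeff α A) (hβ : 0 < coeff β A) (hγ : 0 < coeff γ A)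
    (hα0 : ∃ i, α i = 0) (hβ0 : ∃ i, β i = 0) (hγ0 : ∃ i, γ i = 0)
    (hαβ : α ≠ β) (hαγ : α ≠ γ) (hβγ : β ≠ γ) (h : ∀ i, α i = 0 → β i = 0 → γ i ≠ 0) :
    3 * n - 4 ≤ (A * Ssum n).support.card := by
  have hsub := Finset.card_le_card <| Finset.union_subset (Finset.union_subset
    (shifts_boundaryDirs_subset_support hA hα) (shifts_boundaryDirs_subset_support hA hβ))
    (shifts_boundaryDirs_subset_support hA hγ)
  have h0 := card_union_three (shifts α (boundaryDirs α)) (shifts β (boundaryDirs β))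
    (shifts γ (boundaryDirs γ))
  have h1 := card_inter_add_card_inter_le hα0 hαβ hαγ h (boundaryDirs β) (boundaryDirs γ)
  have h2 := card_inter_add_card_inter_le hβ0 hαβ.symm hβγ (fun i hb ha => h i ha hb)
    (boundaryDirs α) (boundaryDirs γ)
  have h3 := card_inter_add_card_inter_le hγ0 hαγ.symm hβγ.symm (fun i hc ha hb => h i ha hb hc)
    (boundaryDirs α) (boundaryDirs β)
  rw [Finset.inter_comm (shifts β _) (shifts α _)] at h2
  rw [Finset.inter_comm (shifts γ _) (shifts α _), Finset.inter_comm (shifts γ _) (shifts β _)]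
    at h3
  obtain ⟨i, hi⟩ := hα0
  obtain ⟨j, hj⟩ := hβ0
  obtain ⟨k, hk⟩ := hγ0
  have := le_card_boundaryDirs hi
  have := le_card_boundaryDirs hj
  have := le_card_boundaryDirs hk
  simp only [card_shifts] at h0
  omega

theorem exists_two_support_ne_zero (hn : 3 ≤ n) (hd : 1 ≤ d) (hh : A.IsHomogeneous d)
    (hA : ∀ α : Fin n →₀ ℕ, (∃ i, α i = 0) → 0 ≤ coeff α A)
    (hface : ∀ i, ∃ α : Fin n →₀ ℕ, α i = 0 ∧ 0 < coeff α A) (i : Fin n) :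
    ∃ x y, x ≠ y ∧ x i ≠ 0 ∧ y i ≠ 0 ∧ x ∈ (A * Ssum n).support ∧ y ∈ (A * Ssum n).support := by
  by_cases h : ∃ l γ, l ≠ i ∧ γ l = 0 ∧ 0 < coeff γ A ∧ γ i ≠ 0
  · obtain ⟨l, γ, hli, hγl, hγ, hγi⟩ := h
    obtain ⟨b, hbi, hbl⟩ := exists_ne_ne hn i l
    refine ⟨γ + Finsupp.single i 1, γ + Finsupp.single b 1, ?_, by simp, by simp [hγi],
      mem_support_iff.2 (coeff_add_single_pos_of_boundary hA hγ hγl hli).ne',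
      mem_support_iff.2 (coeff_add_single_pos_of_boundary hA hγ hγl hbl.symm).ne'⟩
    intro heq
    exact hbi (Finsupp.single_left_injective one_ne_zero (add_left_cancel heq)).symm
  · push Not at h
    obtain ⟨l, hli, -⟩ := exists_ne_ne hn i i
    obtain ⟨γ, hγl, hγ⟩ := hface l
    obtain ⟨m, hm⟩ : ∃ m, γ m ≠ 0 := by
      by_contra! h0
      have := degree_eq_of_coeff_ne_zero hh hγ.ne'
      simp [h0] at this
      omega
    have hmi : m ≠ i := by
      rintro rfl
      exact hm (h l γ hli hγl hγ)
    obtain ⟨δ, hδm, hδ⟩ := hface m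
    refine ⟨γ + Finsupp.single i 1, δ + Finsupp.single i 1, ?_, by simp, by simp,
      mem_support_iff.2 (coeff_add_single_pos_of_boundary hA hγ hγl hli).ne',
      mem_support_iff.2 (coeff_add_single_pos_of_boundary hA hδ hδm hmi).ne'⟩
    intro heq
    rw [add_right_cancel heq] at hm
    exact hm hδm

/-- Three monomials of `A` with a common missing variable. -/
theorem card_support_ge_of_three_common (hn : 3 ≤ n) (hd : 1 ≤ d) (hh : A.IsHomogeneous d)
    (hA : ∀ α : Fin n →₀ ℕ, (∃ i, α i = 0) → 0 ≤ coeff α A)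
    (hface : ∀ i, ∃ α : Fin n →₀ ℕ, α i = 0 ∧ 0 < coeff α A) {α β γ : Fin n →₀ ℕ}
    (hα : 0 < coeff α A) (hβ : 0 < coeff β A) (hγ : 0 < coeff γ A)
    (hαβ : α ≠ β) (hαγ : α ≠ γ) (hβγ : β ≠ γ) (i : Fin n)
    (hαi : α i = 0) (hβi : β i = 0) (hγi : γ i = 0) :
    3 * n - 4 ≤ (A * Ssum n).support.card := by
  have hsub : ∀ δ : Fin n →₀ ℕ, 0 < coeff δ A → δ i = 0 →
      shifts δ (Finset.univ.erase i) ⊆ (A * Ssum n).support.filter fun x => x i = 0 := by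
    intro δ hδ hδi x hx
    obtain ⟨l, hl, rfl⟩ := mem_shifts.1 hx
    have hli : l ≠ i := Finset.ne_of_mem_erase hl
    exact Finset.mem_filter.2 ⟨mem_support_iff.2
      (coeff_add_single_pos_of_boundary hA hδ hδi hli.symm).ne', by simp [hδi, hli]⟩
  have h0 := Finset.card_le_card <| Finset.union_subset (Finset.union_subset
    (hsub α hα hαi) (hsub β hβ hβi)) (hsub γ hγ hγi)
  have h1 := card_union_three (shifts α (Finset.univ.erase i)) (shifts β (Finset.univ.erase i))
    (shifts γ (Finset.univ.erase i))
  have h2 := card_shifts_inter_le hαβ (Finset.univ.erase i) (Finset.univ.erase i)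
  have h3 := card_shifts_inter_le hαγ (Finset.univ.erase i) (Finset.univ.erase i)
  have h4 := card_shifts_inter_le hβγ (Finset.univ.erase i) (Finset.univ.erase i)
  simp only [card_shifts, Finset.card_erase_of_mem (Finset.mem_univ i), Finset.card_univ,
    Fintype.card_fin] at h1
  obtain ⟨x, y, hxy, hx0, hy0, hx, hy⟩ := exists_two_support_ne_zero hn hd hh hA hface i
  have h5 : ({x, y} : Finset _) ⊆ (A * Ssum n).support.filter fun x => ¬ x i = 0 := by
    intro z hz
    rw [Finset.mem_insert, Finset.mem_singleton] at hz
    rcases hz with rfl | rfl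
    exacts [Finset.mem_filter.2 ⟨hx, hx0⟩, Finset.mem_filter.2 ⟨hy, hy0⟩]
  have h6 := Finset.card_le_card h5
  rw [Finset.card_pair hxy] at h6
  have h7 := Finset.card_filter_add_card_filter_not (s := (A * Ssum n).support) fun x => x i = 0
  omega

/-- Starting from a monomial of `A` involving all variables, move as far as possible in the
direction `i`. -/
theorem exists_extremal_shift {α : Fin n →₀ ℕ} (hh : A.IsHomogeneous d) (hα : coeff α A ≠ 0)
    (hα0 : ∀ i, α i ≠ 0) (i : Fin n) :
    ∃ β : Fin n →₀ ℕ, (∀ j, j ≠ i → β j ≤ α j) ∧ ∑ j, β j = d + 1 ∧ (∀ j, β j ≠ 0) ∧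
      (β ∈ (A * Ssum n).support ∨
        ∃ τ l, coeff τ A ≠ 0 ∧ (∃ k, τ k = 0) ∧ β = τ + Finsupp.single l 1) := by
  obtain ⟨γ, hγ, hmax⟩ := Finset.exists_max_image
    (A.support.filter fun γ => (∀ j, j ≠ i → γ j ≤ α j) ∧ ∀ j, γ j ≠ 0) (fun γ => γ i)
    ⟨α, by simp [hα, hα0]⟩
  simp only [Finset.mem_filter, mem_support_iff, and_imp] at hγ hmax
  obtain ⟨hγ, hle, hγ0⟩ := hγ
  refine ⟨γ + Finsupp.single i 1, fun j hj => by simpa [hj.symm] using hle j hj, ?_,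
    by simp [hγ0], ?_⟩
  · simp only [Finsupp.add_apply, Finset.sum_add_distrib, degree_eq_of_coeff_ne_zero hh hγ,
      Finsupp.single_apply, Finset.sum_ite_eq, Finset.mem_univ, if_true]
  · by_contra! hcon
    obtain ⟨h1, h2⟩ := hcon
    rw [notMem_support_iff, coeff_mul_Ssum, Finset.sum_eq_single i] at h1
    · simp at h1
      exact hγ h1
    · intro l _ hl
      split_ifs with hl0
      · rfl
      by_contra hne
      set τ := γ + Finsupp.single i 1 - Finsupp.single l 1 with hτ
      have hτadd : γ + Finsupp.single i 1 = τ + Finsupp.single l 1 :=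
        (tsub_add_cancel_of_le (Finsupp.single_le_iff.2 (Nat.one_le_iff_ne_zero.2 hl0))).symm
      by_cases hk : ∃ k, τ k = 0
      · exact h2 τ l hne hk hτadd
      · push Not at hk
        have := hmax τ hne (fun j hj => ?_) hk
        · simp [hτ, hl.symm] at this
        · have := hle j hj
          simp [hτ, hj.symm]
          omega
    · simp

/-- At most two boundary monomials, which have no variable in common. -/
theorem card_support_ge_of_two (hd : 2 ≤ d) (hh : A.IsHomogeneous d)
    (hA : ∀ α : Fin n →₀ ℕ, (∃ i, α i = 0) → 0 ≤ coeff α A) {α β δ : Fin n →₀ ℕ}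
    (hα : 0 < coeff α A) (hβ : 0 < coeff β A) (hα0 : ∃ i, α i = 0) (hβ0 : ∃ i, β i = 0)
    (hδ : coeff δ A ≠ 0) (hδ0 : ∀ i, δ i ≠ 0) (hdisj : ∀ i, α i = 0 ∨ β i = 0)
    (hall : ∀ τ : Fin n →₀ ℕ, coeff τ A ≠ 0 → (∃ i, τ i = 0) → τ = α ∨ τ = β) :
    3 * n - 4 ≤ (A * Ssum n).support.card := by
  choose f hfle hfsum hf0 hf using exists_extremal_shift hh hδ hδ0
  have hinj : Function.Injective f := by
    intro i j hij
    by_contra hne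
    have hle : ∀ k, f i k ≤ δ k := fun k => by
      by_cases hk : k = i
      · rw [hij]
        exact hfle j k (by rw [hk]; exact hne)
      · exact hfle i k hk
    have h1 := Finset.sum_le_sum fun k (_ : k ∈ Finset.univ) => hle k
    rw [hfsum, degree_eq_of_coeff_ne_zero hh hδ] at h1
    omega
  let fill : (Fin n →₀ ℕ) → (Fin n →₀ ℕ) := fun τ =>
    Finsupp.equivFunOnFinite.symm fun j => max (τ j) 1
  let W : Finset (Fin n →₀ ℕ) := Finset.univ.image f \ {fill α, fill β}
  have hWcard : n ≤ W.card + 2 := by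
    have h1 := Finset.le_card_sdiff {fill α, fill β} (Finset.univ.image f)
    rw [Finset.card_image_of_injective _ hinj, Finset.card_univ, Fintype.card_fin] at h1
    have h2 : ({fill α, fill β} : Finset _).card ≤ 2 := Finset.card_le_two
    have h3 : W.card = (Finset.univ.image f \ {fill α, fill β}).card := rfl
    omega
  have hWint : ∀ x ∈ W, ∀ j, x j ≠ 0 := by
    intro x hx
    obtain ⟨i, -, rfl⟩ := Finset.mem_image.1 (Finset.mem_sdiff.1 hx).1
    exact hf0 i
  have hWsub : W ⊆ (A * Ssum n).support := by
    intro x hx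
    obtain ⟨hx1, hx2⟩ := Finset.mem_sdiff.1 hx
    obtain ⟨i, -, rfl⟩ := Finset.mem_image.1 hx1
    refine (hf i).resolve_right ?_
    rintro ⟨τ, l, hτ, ⟨k, hk⟩, heq⟩
    have hfill : f i = fill τ := by
      have hval : ∀ j, f i j = τ j + if l = j then 1 else 0 := fun j => by
        rw [heq, Finsupp.add_apply, Finsupp.single_apply]
      have hkl : l = k := by
        by_contra hne
        have := hf0 i k
        rw [hval, if_neg hne, hk] at this
        exact this rfl
      ext j
      have h1 := hf0 i j
      change f i j = max (τ j) 1
      rw [hval] at h1 ⊢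
      split_ifs at h1 ⊢ with hlj
      · rw [← hlj, hkl, hk]
        rfl
      · omega
    apply hx2
    rw [hfill]
    rcases hall τ hτ ⟨k, hk⟩ with rfl | rfl <;> simp
  have hbd : ∀ (τ x : Fin n →₀ ℕ), x ∈ shifts τ (boundaryDirs τ) → x ∉ W := by
    intro τ x hx hxW
    obtain ⟨l, hl, rfl⟩ := mem_shifts.1 hx
    obtain ⟨i, hil, hi⟩ := mem_boundaryDirs.1 hl
    exact hWint _ hxW i (by simp [hi, hil.symm])
  have hαβ : Disjoint (shifts α (boundaryDirs α)) (shifts β (boundaryDirs β)) := by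
    rw [Finset.disjoint_left]
    intro x hx hx'
    obtain ⟨l, -, rfl⟩ := mem_shifts.1 hx
    obtain ⟨m, -, h⟩ := mem_shifts.1 hx'
    have hle : ∀ i, α i ≤ Finsupp.single m 1 i := fun i => by
      have h1 := DFunLike.congr_fun h i
      simp only [Finsupp.add_apply] at h1
      rcases hdisj i with h2 | h2 <;> omega
    have h1 := Finset.sum_le_sum fun k (_ : k ∈ Finset.univ) => hle k
    rw [degree_eq_of_coeff_ne_zero hh hα.ne'] at h1
    simp [Finsupp.single_apply] at h1
    omega
  have hsub := Finset.card_le_card <| Finset.union_subset (Finset.union_subset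
    (shifts_boundaryDirs_subset_support hA hα) (shifts_boundaryDirs_subset_support hA hβ)) hWsub
  rw [Finset.card_union_of_disjoint, Finset.card_union_of_disjoint hαβ, card_shifts,
    card_shifts] at hsub
  · obtain ⟨i, hi⟩ := hα0
    obtain ⟨j, hj⟩ := hβ0
    have := le_card_boundaryDirs hi
    have := le_card_boundaryDirs hj
    omega
  · rw [Finset.disjoint_left]
    intro x hx
    rcases Finset.mem_union.1 hx with hx | hx
    exacts [hbd α x hx, hbd β x hx]

theorem card_support_ge_of_boundary_nonneg (hn : 3 ≤ n) (hd : 2 ≤ d) (hh : A.IsHomogeneous d)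
    (hA : ∀ α : Fin n →₀ ℕ, (∃ i, α i = 0) → 0 ≤ coeff α A)
    (hface : ∀ i, ∃ α : Fin n →₀ ℕ, α i = 0 ∧ 0 < coeff α A)
    (hneg : ∃ α, coeff α A < 0) : 3 * n - 4 ≤ (A * Ssum n).support.card := by
  obtain ⟨δ, hδ⟩ := hneg
  have hδ0 : ∀ i, δ i ≠ 0 := fun i hi => (hA δ ⟨i, hi⟩).not_gt hδ
  obtain ⟨α, hα0, hα⟩ := hface ⟨0, by omega⟩
  obtain ⟨m, hm⟩ : ∃ m, α m ≠ 0 := by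
    by_contra! h0
    have := degree_eq_of_coeff_ne_zero hh hα.ne'
    simp [h0] at this
    omega
  obtain ⟨β, hβ0, hβ⟩ := hface m
  have hαβ : α ≠ β := by
    rintro rfl
    exact hm hβ0
  by_cases h3 : ∃ γ, 0 < coeff γ A ∧ (∃ i, γ i = 0) ∧ γ ≠ α ∧ γ ≠ β
  · obtain ⟨γ, hγ, hγ0, hγα, hγβ⟩ := h3
    by_cases hc : ∃ i, α i = 0 ∧ β i = 0 ∧ γ i = 0
    · obtain ⟨i, h1, h2, h3⟩ := hc
      exact card_support_ge_of_three_common hn (by omega) hh hA hface hα hβ hγ hαβ hγα.symm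
        hγβ.symm i h1 h2 h3
    · push Not at hc
      exact card_support_ge_of_three_not_common hA hα hβ hγ ⟨_, hα0⟩ ⟨_, hβ0⟩ hγ0 hαβ hγα.symm
        hγβ.symm hc
  · have hall : ∀ τ : Fin n →₀ ℕ, coeff τ A ≠ 0 → (∃ i, τ i = 0) → τ = α ∨ τ = β := by
      intro τ hτ hτ0
      by_contra! hne
      exact h3 ⟨τ, (hA τ hτ0).lt_of_ne hτ.symm, hτ0, hne⟩
    refine card_support_ge_of_two hd hh hA hα hβ ⟨_, hα0⟩ ⟨_, hβ0⟩ hδ.ne hδ0 (fun i => ?_) hall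
    obtain ⟨τ, hτ0, hτ⟩ := hface i
    rcases hall τ hτ.ne' ⟨i, hτ0⟩ with rfl | rfl
    exacts [Or.inl hτ0, Or.inr hτ0]

end BoundaryNonneg

section PowersOfSsum

variable {n : ℕ}

theorem coeff_Ssum_pow_pos {k : ℕ} {γ : Fin n →₀ ℕ} (hγ : ∑ i, γ i = k) :
    0 < coeff γ (Ssum n ^ k) := by
  induction k generalizing γ with
  | zero =>
    have : γ = 0 := by
      ext i
      exact (Finset.sum_eq_zero_iff.1 hγ) i (Finset.mem_univ i)
    simp [this]
  | succ k ih =>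
    obtain ⟨i, -, hi⟩ := Finset.exists_ne_zero_of_sum_ne_zero (hγ.trans_ne k.succ_ne_zero)
    obtain ⟨δ, rfl⟩ := exists_add_of_le (Finsupp.single_le_iff.2 (Nat.one_le_iff_ne_zero.2 hi))
    rw [add_comm, pow_succ]
    refine coeff_add_single_pos (fun j _ => (coeffNonneg_Ssum n).pow k _) (ih ?_)
    simp [Finset.sum_add_distrib, Finsupp.single_apply] at hγ
    omega

theorem coeff_single_Ssum_pow (a : Fin n) (k : ℕ) :
    coeff (Finsupp.single a k) (Ssum n ^ k) = 1 := by
  induction k with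
  | zero => simp
  | succ k ih =>
    rw [pow_succ, coeff_mul_Ssum, Finset.sum_eq_single a]
    · rw [← Finsupp.single_tsub]
      simp [ih]
    · intro l _ hl
      simp [hl.symm]
    · simp

theorem coeffNonneg_Ssum_pow_sub (a : Fin n) (r : ℕ) : CoeffNonneg (Ssum n ^ r - X a ^ r) := by
  intro γ
  rw [coeff_sub, coeff_X_pow]
  split_ifs with h
  · rw [← h, coeff_single_Ssum_pow, sub_self]
  · simpa using (coeffNonneg_Ssum n).pow r γ

theorem sq_card_le_card_filter {j : ℕ} {u : Fin n →₀ ℕ} (hu : 3 ≤ ∑ i, u i)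
    (hsupp : ∀ a, ∃ b, b ≠ a ∧ u b ≠ 0) :
    n ^ 2 ≤ ((Finset.univ : Finset (Fin n × Fin n)).filter fun p =>
      ¬ u ≤ Finsupp.single p.1 j + Finsupp.single p.2 1).card + 1 := by
  have hbad : ((Finset.univ : Finset (Fin n × Fin n)).filter fun p =>
      u ≤ Finsupp.single p.1 j + Finsupp.single p.2 1).card ≤ 1 := by
    have key : ∀ a l : Fin n, u ≤ Finsupp.single a j + Finsupp.single l 1 →
        2 ≤ u a ∧ (∀ c, c ≠ a → u c ≤ 1) ∧ ∀ c, c ≠ a → u c ≠ 0 → c = l := by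
      intro a l h
      have hc : ∀ c, c ≠ a → u c ≤ if l = c then 1 else 0 := fun c hca => by
        simpa [Finsupp.single_apply, hca.symm] using h c
      refine ⟨?_, fun c hca => (hc c hca).trans (by split_ifs <;> omega), fun c hca hc0 => ?_⟩
      · have hle : ∀ c, u c ≤ (if a = c then u a else 0) + if l = c then 1 else 0 := fun c => by
          by_cases hca : a = c
          · simp [hca]
          · simpa [hca] using hc c (Ne.symm hca)
        have := Finset.sum_le_sum fun c (_ : c ∈ Finset.univ) => hle c
        simp [Finset.sum_add_distrib] at this
        omega
      · have := hc c hca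
        split_ifs at this with hlc
        · exact hlc.symm
        · omega
    rw [Finset.card_le_one]
    rintro ⟨a, l⟩ h ⟨a', l'⟩ h'
    obtain ⟨h1, h2, h3⟩ := key a l (Finset.mem_filter.1 h).2
    obtain ⟨h1', h2', h3'⟩ := key a' l' (Finset.mem_filter.1 h').2
    have haa : a = a' := by
      by_contra hne
      have := h2' a hne
      omega
    subst haa
    obtain ⟨b, hba, hb⟩ := hsupp a
    rw [← h3 b hba hb, ← h3' b hba hb]
  have h := Finset.card_filter_add_card_filter_not (s := (Finset.univ : Finset (Fin n × Fin n)))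
    fun p => u ≤ Finsupp.single p.1 j + Finsupp.single p.2 1
  rw [Finset.card_univ, Fintype.card_prod, Fintype.card_fin] at h
  rw [pow_two]
  omega

theorem card_support_ge_of_two_term {n j k : ℕ} (hn : 2 ≤ n) {μ ν : Fin n →₀ ℕ} {c c' : ℝ}
    (hc : 0 < c) (hc' : 0 < c') (hj : Odd j) (hk : Even k) (hk0 : k ≠ 0)
    (hdeg : ∑ i, μ i + j = ∑ i, ν i + k) {B : MvPolynomial (Fin n) ℝ}
    (hB : B = monomial μ c * Ssum n ^ (j - 1) - monomial ν c' * Ssum n ^ (k - 1))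
    (hpos : CoeffNonneg (B * Ssum n)) (hneg : ¬ CoeffNonneg B) :
    3 * n - 3 ≤ (B * Ssum n).support.card := by
  have hj0 : j ≠ 0 := by
    rintro rfl
    simp at hj
  have hP : B * Ssum n = monomial μ c * Ssum n ^ j - monomial ν c' * Ssum n ^ k := by
    rw [hB, sub_mul, mul_assoc, mul_assoc, pow_sub_one_mul hj0, pow_sub_one_mul hk0]
  rw [hP] at hpos ⊢
  have hμν : μ ≤ ν := by
    intro l
    obtain ⟨a, ha⟩ : ∃ a : Fin n, a ≠ l := by
      have : Nontrivial (Fin n) := Fin.nontrivial_iff_two_le.2 hn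
      exact exists_ne l
    have h := hpos (ν + Finsupp.single a k)
    rw [coeff_sub, coeff_monomial_mul', coeff_monomial_mul, coeff_single_Ssum_pow] at h
    split_ifs at h with hle
    · simpa [ha] using hle l
    · linarith
  obtain ⟨u, rfl⟩ := exists_add_of_le hμν
  simp only [Finsupp.add_apply, Finset.sum_add_distrib] at hdeg
  have hju : j = ∑ i, u i + k := by omega
  have hpure : ∀ a, ∃ b, b ≠ a ∧ u b ≠ 0 := by
    intro a
    by_contra! hcon
    have hu : u = Finsupp.single a (u a) := by
      ext b
      rw [Finsupp.single_apply]
      split_ifs with h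
      · rw [h]
      · exact hcon b (Ne.symm h)
    have hj' : j = u a + k := by
      rw [hju, Finset.sum_eq_single a (fun b _ hb => hcon b hb) (by simp)]
    have hcc : c' ≤ c := by
      have h := hpos (μ + Finsupp.single a j)
      have h2 : μ + Finsupp.single a j = μ + u + Finsupp.single a k := by
        rw [add_assoc, hj', Finsupp.single_add, ← hu]
      rw [coeff_sub, coeff_monomial_mul, coeff_single_Ssum_pow, h2, coeff_monomial_mul,
        coeff_single_Ssum_pow] at h
      linarith
    refine hneg ?_
    have hB' : B = monomial μ 1 * (monomial 0 (c - c') * Ssum n ^ (j - 1) +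
        monomial 0 c' * (Ssum n ^ (k - 1) * (Ssum n ^ u a - X a ^ u a))) := by
      have h1 : monomial (μ + u) c' = monomial μ (1 : ℝ) * (C c' * X a ^ u a) := by
        rw [C_mul_X_pow_eq_monomial, monomial_mul, one_mul, ← hu]
      have h2 : monomial μ c = monomial μ (1 : ℝ) * C c := by
        rw [C_apply, monomial_mul, one_mul, add_zero]
      have h3 : j - 1 = k - 1 + u a := by omega
      rw [hB, h1, h2, ← C_apply, ← C_apply, C_sub, h3, pow_add]
      ring
    rw [hB']
    have hS := coeffNonneg_Ssum n
    exact (CoeffNonneg.monomial _ zero_le_one).mul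
      (((CoeffNonneg.monomial _ (sub_nonneg.2 hcc)).mul (hS.pow _)).add
        ((CoeffNonneg.monomial _ hc'.le).mul ((hS.pow _).mul (coeffNonneg_Ssum_pow_sub a _))))
  have hu3 : 3 ≤ ∑ i, u i := by
    obtain ⟨a, -, ha⟩ := hpure ⟨0, by omega⟩
    obtain ⟨b, hba, hb⟩ := hpure a
    have h1 : u a + u b ≤ ∑ i, u i := by
      rw [← Finset.sum_pair hba.symm]
      exact Finset.sum_le_sum_of_subset (Finset.subset_univ _)
    have h2 : Odd (∑ i, u i) := by
      rw [hju] at hj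
      exact (Nat.odd_add.1 hj).2 hk
    obtain ⟨t, ht⟩ := h2
    omega
  have hinj : Function.Injective fun p : Fin n × Fin n =>
      μ + (Finsupp.single p.1 (j - 1) + Finsupp.single p.2 1) := by
    rintro ⟨a, l⟩ ⟨a', l'⟩ h
    have h := add_left_cancel h
    have haa : a = a' := by
      by_contra hne
      have h1 := DFunLike.congr_fun h a
      simp only [Finsupp.add_apply, Finsupp.single_apply, if_true, if_neg (Ne.symm hne)] at h1
      split_ifs at h1 <;> omega
    subst haa
    have hll := Finsupp.single_left_injective one_ne_zero (add_left_cancel h)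
    exact Prod.ext rfl hll
  have hsub : ((Finset.univ : Finset (Fin n × Fin n)).filter fun p =>
      ¬ u ≤ Finsupp.single p.1 (j - 1) + Finsupp.single p.2 1).image
        (fun p => μ + (Finsupp.single p.1 (j - 1) + Finsupp.single p.2 1)) ⊆
      (monomial μ c * Ssum n ^ j - monomial (μ + u) c' * Ssum n ^ k).support := by
    intro x hx
    obtain ⟨⟨a, l⟩, hp, rfl⟩ := Finset.mem_image.1 hx
    have hp := (Finset.mem_filter.1 hp).2
    rw [mem_support_iff, coeff_sub, coeff_monomial_mul, coeff_monomial_mul',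
      if_neg (fun h => hp ((add_le_add_iff_left μ).1 h)), sub_zero]
    refine (mul_pos hc (coeff_Ssum_pow_pos ?_)).ne'
    simp only [Finsupp.add_apply, Finset.sum_add_distrib, Finsupp.single_apply,
      Finset.sum_ite_eq, Finset.mem_univ, if_true]
    omega
  have h1 := Finset.card_le_card hsub
  rw [Finset.card_image_of_injective _ hinj] at h1
  have h2 := sq_card_le_card_filter (j := j - 1) hu3 hpure
  have h3 : 3 * n ≤ n ^ 2 + 2 := by nlinarith
  omega

end PowersOfSsum

section Substitution

variable {m : ℕ}

/-- Substitute `t` for the variable `X i` and rename the remaining variables. -/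
noncomputable def substVar (i : Fin (m + 1)) (t : MvPolynomial (Fin m) ℝ) :
    MvPolynomial (Fin (m + 1)) ℝ →ₐ[ℝ] MvPolynomial (Fin m) ℝ :=
  aeval (i.insertNth (α := fun _ => MvPolynomial (Fin m) ℝ) t X)

/-- Delete the `i`-th exponent. -/
noncomputable def dropExp (i : Fin (m + 1)) (β : Fin (m + 1) →₀ ℕ) : Fin m →₀ ℕ :=
  Finsupp.equivFunOnFinite.symm fun j => β (i.succAbove j)

theorem dropExp_apply (i : Fin (m + 1)) (β : Fin (m + 1) →₀ ℕ) (j : Fin m) :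
    dropExp i β j = β (i.succAbove j) := rfl

theorem dropExp_inj {i : Fin (m + 1)} {β γ : Fin (m + 1) →₀ ℕ} (hi : β i = γ i)
    (h : dropExp i β = dropExp i γ) : β = γ := by
  ext j
  rcases i.eq_self_or_eq_succAbove j with rfl | ⟨k, rfl⟩
  · exact hi
  · rw [← dropExp_apply, h, dropExp_apply]

theorem substVar_eq_sum (i : Fin (m + 1)) (t : MvPolynomial (Fin m) ℝ)
    (P : MvPolynomial (Fin (m + 1)) ℝ) :
    substVar i t P = ∑ β ∈ P.support, monomial (dropExp i β) (coeff β P) * t ^ β i := by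
  rw [substVar, aeval_def, eval₂_eq']
  refine Finset.sum_congr rfl fun β _ => ?_
  rw [Fin.prod_univ_succAbove _ i, monomial_eq, Finsupp.prod_fintype _ _ (by simp)]
  simp only [Fin.insertNth_apply_same, Fin.insertNth_apply_succAbove, algebraMap_eq,
    dropExp_apply]
  ring

theorem substVar_Ssum (i : Fin (m + 1)) (t : MvPolynomial (Fin m) ℝ) :
    substVar i t (Ssum (m + 1)) = t + Ssum m := by
  simp [substVar, Ssum, Fin.sum_univ_succAbove _ i]

theorem coeff_substVar_zero (i : Fin (m + 1)) (P : MvPolynomial (Fin (m + 1)) ℝ)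
    {β : Fin (m + 1) →₀ ℕ} (hβ : β i = 0) :
    coeff (dropExp i β) (substVar i 0 P) = coeff β P := by
  rw [substVar_eq_sum, coeff_sum, Finset.sum_eq_single β]
  · simp [hβ]
  · intro γ _ hγ
    by_cases hγi : γ i = 0
    · rw [hγi, pow_zero, mul_one, coeff_monomial, if_neg]
      exact fun h => hγ (dropExp_inj (hγi.trans hβ.symm) h)
    · simp [hγi]
  · intro h
    simp [notMem_support_iff.1 h]

theorem substVar_zero_eq_sum (i : Fin (m + 1)) (P : MvPolynomial (Fin (m + 1)) ℝ) :
    substVar i 0 P = ∑ β ∈ P.support with β i = 0, monomial (dropExp i β) (coeff β P) := by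
  rw [substVar_eq_sum, Finset.sum_filter]
  refine Finset.sum_congr rfl fun β _ => ?_
  split_ifs with h <;> simp [h]

theorem CoeffNonneg.substVar_zero {P : MvPolynomial (Fin (m + 1)) ℝ} (hP : CoeffNonneg P)
    (i : Fin (m + 1)) : CoeffNonneg (substVar i 0 P) := by
  rw [substVar_zero_eq_sum]
  exact CoeffNonneg.sum fun β _ => CoeffNonneg.monomial _ (hP β)

theorem card_support_substVar_zero_le (i : Fin (m + 1)) (P : MvPolynomial (Fin (m + 1)) ℝ) :
    (substVar i 0 P).support.card ≤ (P.support.filter fun β => β i = 0).card := by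
  refine le_trans (Finset.card_le_card fun γ hγ => ?_)
    (Finset.card_image_le (f := dropExp i))
  rw [mem_support_iff, substVar_zero_eq_sum, coeff_sum] at hγ
  obtain ⟨β, hβ, hne⟩ := Finset.exists_ne_zero_of_sum_ne_zero hγ
  rw [coeff_monomial] at hne
  exact Finset.mem_image.2 ⟨β, hβ, by_contra fun h => hne (if_neg h)⟩

/-- The restriction of `A` to `X i = 0` is determined by the monomials of `A * Ssum (m + 1)` that
are divisible by `X i`. -/
theorem substVar_zero_eq_sum_pow (hm : 0 < m) (i : Fin (m + 1))
    (A : MvPolynomial (Fin (m + 1)) ℝ) :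
    substVar i 0 A = ∑ β ∈ (A * Ssum (m + 1)).support with ¬ β i = 0,
      monomial (dropExp i β) (coeff β (A * Ssum (m + 1))) * (-Ssum m) ^ (β i - 1) := by
  apply mul_right_cancel₀ (Ssum_ne_zero hm)
  have h0 : substVar i (-Ssum m) (A * Ssum (m + 1)) = 0 := by
    rw [map_mul, substVar_Ssum, neg_add_cancel, mul_zero]
  have h1 : substVar i 0 A * Ssum m = substVar i 0 (A * Ssum (m + 1)) := by
    rw [map_mul, substVar_Ssum, zero_add]
  rw [substVar_eq_sum, ← Finset.sum_filter_add_sum_filter_not _ fun β => β i = 0] at h0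
  rw [h1, substVar_zero_eq_sum, Finset.sum_mul]
  have h2 : ∑ β ∈ (A * Ssum (m + 1)).support with β i = 0,
      monomial (dropExp i β) (coeff β (A * Ssum (m + 1))) * (-Ssum m) ^ β i =
      ∑ β ∈ (A * Ssum (m + 1)).support with β i = 0,
        monomial (dropExp i β) (coeff β (A * Ssum (m + 1))) :=
    Finset.sum_congr rfl fun β hβ => by simp [(Finset.mem_filter.1 hβ).2]
  rw [h2] at h0
  rw [eq_neg_of_add_eq_zero_left h0, ← Finset.sum_neg_distrib]
  refine Finset.sum_congr rfl fun β hβ => ?_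
  rw [← pow_sub_one_mul (Finset.mem_filter.1 hβ).2]
  ring

theorem card_support_ge_of_face_neg {d : ℕ} (hm : 2 ≤ m) {A : MvPolynomial (Fin (m + 1)) ℝ}
    (hA : A.IsHomogeneous d) (hpos : CoeffNonneg (A * Ssum (m + 1))) {i : Fin (m + 1)}
    (hneg : ∃ α : Fin (m + 1) →₀ ℕ, α i = 0 ∧ coeff α A < 0) :
    min (3 + rho m d) ((3 * (m + 1) - 4 : ℕ) : ℕ∞) ≤ ((A * Ssum (m + 1)).support.card : ℕ∞) := by
  set P := A * Ssum (m + 1) with hP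
  set B := substVar i 0 A with hBdef
  have hBS : substVar i 0 P = B * Ssum m := by rw [hP, map_mul, substVar_Ssum, zero_add]
  have hBpos : CoeffNonneg (B * Ssum m) := hBS ▸ hpos.substVar_zero i
  have hBneg : ∃ mo, coeff mo B < 0 := by
    obtain ⟨α, hα, hlt⟩ := hneg
    exact ⟨dropExp i α, by rwa [coeff_substVar_zero i A hα]⟩
  have hBnot : ¬ CoeffNonneg B := fun h => hBneg.elim fun mo hmo => (h mo).not_gt hmo
  have hcard := card_support_substVar_zero_le i P
  rw [hBS] at hcard
  have hsplit := Finset.card_filter_add_card_filter_not (s := P.support) fun β => β i = 0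
  have hBsum := substVar_zero_eq_sum_pow (by omega) i A
  rw [← hP, ← hBdef] at hBsum
  set F := P.support.filter fun β => ¬ β i = 0 with hF
  by_cases h3 : 3 ≤ F.card
  · refine (min_le_left _ _).trans ?_
    have hBhom : B.IsHomogeneous d := by
      rw [← one_mul d]
      refine hA.aeval _ fun j => ?_
      rcases i.eq_self_or_eq_succAbove j with rfl | ⟨k, rfl⟩
      · simpa using isHomogeneous_zero (Fin m) ℝ 1
      · simpa using isHomogeneous_X ℝ k
    have hrho : rho m d ≤ ((B * Ssum m).support.card : ℕ∞) :=
      sInf_le ⟨B, hBhom, hBneg, hBpos, rfl⟩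
    calc 3 + rho m d ≤ ((3 : ℕ) : ℕ∞) + ((B * Ssum m).support.card : ℕ∞) :=
          add_le_add le_rfl hrho
      _ = ((3 + (B * Ssum m).support.card : ℕ) : ℕ∞) := (Nat.cast_add _ _).symm
      _ ≤ _ := Nat.cast_le.2 (by omega)
  · refine (min_le_right _ _).trans (Nat.cast_le.2 ?_)
    have hcoeff : ∀ β ∈ F, 0 < coeff β P := fun β hβ =>
      (hpos β).lt_of_ne (mem_support_iff.1 (Finset.mem_filter.1 hβ).1).symm
    have hexp : ∀ β ∈ F, β i ≠ 0 := fun β hβ => (Finset.mem_filter.1 hβ).2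
    have hS := coeffNonneg_Ssum m
    obtain ⟨γ, hγ, hγi⟩ : ∃ γ ∈ F, Even (γ i) := by
      by_contra! hodd
      refine hBnot ?_
      rw [hBsum]
      refine CoeffNonneg.sum fun β hβ => ?_
      rw [Even.neg_pow (Nat.Odd.sub_odd (Nat.not_even_iff_odd.1 (hodd β hβ)) odd_one)]
      exact (CoeffNonneg.monomial _ (hcoeff β hβ).le).mul (hS.pow _)
    obtain ⟨β, hβ, hβi⟩ : ∃ β ∈ F, Odd (β i) := by
      by_contra! heven
      have hB0 : CoeffNonneg (-(B * Ssum m)) := by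
        rw [hBsum, ← neg_mul, ← Finset.sum_neg_distrib]
        refine (CoeffNonneg.sum fun δ hδ => ?_).mul hS
        have h1 : Odd (δ i - 1) :=
          Nat.Even.sub_odd (Nat.one_le_iff_ne_zero.2 (hexp δ hδ))
            (Nat.not_odd_iff_even.1 (heven δ hδ)) odd_one
        rw [Odd.neg_pow h1, mul_neg, neg_neg]
        exact (CoeffNonneg.monomial _ (hcoeff δ hδ).le).mul (hS.pow _)
      have hz : B * Ssum m = 0 := by
        ext mo
        have h1 := hB0 mo
        have h2 := hBpos mo
        rw [coeff_neg] at h1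
        rw [coeff_zero]
        linarith
      rcases mul_eq_zero.1 hz with h | h
      · obtain ⟨mo, hmo⟩ := hBneg
        simp [h] at hmo
      · exact Ssum_ne_zero (by omega) h
    have hβγ : β ≠ γ := by
      rintro rfl
      exact Nat.not_even_iff_odd.2 hβi hγi
    have hFeq : F = {β, γ} := by
      refine (Finset.eq_of_subset_of_card_le (fun x hx => ?_) ?_).symm
      · rcases Finset.mem_insert.1 hx with rfl | hx
        · exact hβ
        · rwa [Finset.mem_singleton.1 hx]
      · rw [Finset.card_pair hβγ]
        omega
    have hPhom : P.IsHomogeneous (d + 1) := hA.mul (Ssum_isHomogeneous (m + 1))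
    have hdegβ := degree_eq_of_coeff_ne_zero hPhom (hcoeff β hβ).ne'
    have hdegγ := degree_eq_of_coeff_ne_zero hPhom (hcoeff γ hγ).ne'
    rw [Fin.sum_univ_succAbove _ i] at hdegβ hdegγ
    have h := card_support_ge_of_two_term hm (μ := dropExp i β) (ν := dropExp i γ)
      (hcoeff β hβ) (hcoeff γ hγ) hβi hγi (hexp γ hγ)
      (by simp only [dropExp_apply]; omega) (B := B) ?_ hBpos hBnot
    · rw [hFeq, Finset.card_pair hβγ] at hsplit
      omega
    · rw [hBsum, hFeq, Finset.sum_pair hβγ, Even.neg_pow (Nat.Odd.sub_odd hβi odd_one),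
        Odd.neg_pow (Nat.Even.sub_odd (Nat.one_le_iff_ne_zero.2 (hexp γ hγ)) hγi odd_one)]
      ring

end Substitution

/-- The key recursive inequality of Section 5:
`R_{n,d} ≥ min{R_{n,d−1}, 3 + R_{n−1,d}, 3n − 4}` for `n, d ≥ 3`. -/
theorem stmt18 (n d : ℕ) (hn : 3 ≤ n) (hd : 3 ≤ d)
    (A : MvPolynomial (Fin n) ℝ) (hA : A.IsHomogeneous d)
    (hneg : ∃ mo, coeff mo A < 0)
    (hpos : ∀ mo, 0 ≤ coeff mo (A * Ssum n)) :
    min (min (rho n (d - 1)) (3 + rho (n - 1) d)) ((3 * n - 4 : ℕ) : ℕ∞) ≤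
      ((A * Ssum n).support.card : ℕ∞) := by
  by_cases h1 : ∃ i, ∀ α : Fin n →₀ ℕ, α i = 0 → coeff α A = 0
  · obtain ⟨i, hi⟩ := h1
    exact (min_le_left _ _).trans <| (min_le_left _ _).trans <|
      rho_pred_le_of_X_dvd hA (by omega) hneg hpos i hi
  by_cases h2 : ∃ i, ∃ α : Fin n →₀ ℕ, α i = 0 ∧ coeff α A < 0
  · obtain ⟨i, hi⟩ := h2
    obtain ⟨m, rfl⟩ : ∃ m, n = m + 1 := ⟨n - 1, by omega⟩
    exact (min_le_min_right _ (min_le_right _ _)).trans <|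
      card_support_ge_of_face_neg (by omega) hA hpos hi
  · push Not at h1 h2
    refine (min_le_right _ _).trans (Nat.cast_le.2 ?_)
    refine card_support_ge_of_boundary_nonneg hn (by omega) hA
      (fun α ⟨i, hi⟩ => h2 i α hi) (fun i => ?_) hneg
    obtain ⟨α, hα, hne⟩ := h1 i
    exact ⟨α, hα, (h2 i α hα).lt_of_ne hne.symm⟩
end
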